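/- Let P be an 8-point set in general position of convex layer type (4,4), with inner convex quadrilateral ABCD and outer points E, F, G, H, such that each of the 4 outer points lies in a distinct I-region of the inner convex quadrilateral (configuration 8), namely the outer point beyond vertex A (and likewise beyond B, C, D) lies in the cone region where it forms a (4,1)-type set with ABCD. Then for any additional point x with P ∪ {x} in general position, P ∪ {x} contains an empty convex pentagon. -/

import Mathlib

open scoped Classical
noncomputable section

/-- Points in the plane. -/
abbrev Pt := ℝ × ℝ

/-- Signed area determinant of the triple (p, q, r). -/
def det (p q r : Pt) : ℝ := (q.1 - p.1) * (r.2 - p.2) - (q.2 - p.2) * (r.1 - p.1)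

/-- A finite point set is in general position if no three distinct points are collinear. -/
def GenPos (S : Finset Pt) : Prop :=
  ∀ p ∈ S, ∀ q ∈ S, ∀ r ∈ S, p ≠ q → p ≠ r → q ≠ r → ¬ Collinear ℝ ({p, q, r} : Set Pt)

/-- A finite point set is in convex position if no point lies in the
convex hull of the others. -/
def ConvexPos (S : Finset Pt) : Prop :=
  ∀ p ∈ S, p ∉ convexHull ℝ ((S.erase p : Finset Pt) : Set Pt)

/-- The vertices of the convex hull of a finite point set. -/
def hullVerts (S : Finset Pt) : Finset Pt :=
  S.filter (fun p => p ∉ convexHull ℝ ((S.erase p : Finset Pt) : Set Pt))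

/-- `S` is an empty convex pentagon of the point set `P`. -/
def EmptyConvexPentagon (P S : Finset Pt) : Prop :=
  S ⊆ P ∧ S.card = 5 ∧ ConvexPos S ∧
    ∀ p ∈ P, p ∉ S → p ∉ interior (convexHull ℝ (S : Set Pt))

/-- Type-1 beam `a : bc`: the convex cone with apex `a` spanned by the rays from `a`
through `b` and through `c`, minus the triangle `abc`. -/
def beam1 (a b c : Pt) : Set Pt :=
  {x | (∃ s t : ℝ, 0 ≤ s ∧ 0 ≤ t ∧ x = a + s • (b - a) + t • (c - a)) ∧
       x ∉ convexHull ℝ ({a, b, c} : Set Pt)}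

/-- Type-2 beam `pq : rs`: the convex region bounded by the segment `pq`, the ray
from `p` through `s` and the ray from `q` through `r`, minus the quadrilateral `pqrs`. -/
def beam2 (p q r s : Pt) : Set Pt :=
  {x | (∃ y ∈ segment ℝ p q, ∃ u v : ℝ, 0 ≤ u ∧ 0 ≤ v ∧ x = y + u • (s - p) + v • (r - q)) ∧
       x ∉ convexHull ℝ ({p, q, r, s} : Set Pt)}

/-- The O-region of triangle `abc` opposite the vertex `a`: points separated from `a`
by line `bc`, on the same side of line `ac` as `b`, and on the same side of line `ab` as `c`. -/
def ORegionOpp (a b c : Pt) : Set Pt :=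
  {x | det b c x * det b c a < 0 ∧ det a c x * det a c b > 0 ∧ det a b x * det a b c > 0}

/-- The I-region of triangle (or quadrilateral) at vertex `a` relative to the remaining
vertex set `R`: points `x` such that `a` lies strictly inside the convex hull of `{x} ∪ R`. -/
def IRegion (a : Pt) (R : Set Pt) : Set Pt :=
  {x | a ∈ interior (convexHull ℝ (insert x R))}

/-- A convex quadrilateral with vertices `a b c d` in this cyclic order. -/
def CyclicQuad (a b c d : Pt) : Prop :=
  ConvexPos ({a, b, c, d} : Finset Pt) ∧ ({a, b, c, d} : Finset Pt).card = 4 ∧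
    det a c b * det a c d < 0 ∧ det b d a * det b d c < 0

/-- Configuration 8: an 8-point set in general position with outer convex layer
{E,F,G,H} and inner convex layer {A,B,C,D}, each outer point lying in a distinct
I-region of the inner quadrilateral (E beyond A, F beyond B, G beyond C, H beyond D). -/
def Config8 (A B C D E F G H : Pt) : Prop :=
  ({A, B, C, D, E, F, G, H} : Finset Pt).card = 8 ∧
  GenPos ({A, B, C, D, E, F, G, H} : Finset Pt) ∧
  hullVerts ({A, B, C, D, E, F, G, H} : Finset Pt) = ({E, F, G, H} : Finset Pt) ∧
  hullVerts (({A, B, C, D, E, F, G, H} : Finset Pt) \ ({E, F, G, H} : Finset Pt)) =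
    ({A, B, C, D} : Finset Pt) ∧
  E ∈ IRegion A ({B, C, D} : Set Pt) ∧
  F ∈ IRegion B ({A, C, D} : Set Pt) ∧
  G ∈ IRegion C ({A, B, D} : Set Pt) ∧
  H ∈ IRegion D ({A, B, C} : Set Pt)

/-- The triple `(a, b, c)` is counterclockwise. -/
def Ccw (a b c : Pt) : Prop := 0 < det a b c

theorem Ccw.rot {a b c : Pt} (h : Ccw a b c) : Ccw b c a := by
  unfold Ccw det at *; linarith

theorem Ccw.ne {a b c : Pt} (h : Ccw a b c) : a ≠ b := by
  rintro rfl
  simp [Ccw, det] at h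

theorem Ccw.not_swap {a b c : Pt} (h : Ccw a b c) (h₁ : Ccw a c b) : False := by
  unfold Ccw det at *; linarith

theorem Ccw.det_neg {a b c : Pt} (h : Ccw a b c) : det b a c < 0 := by
  unfold Ccw det at *; linarith

theorem det_self_right (p q : Pt) : det p q q = 0 := by
  unfold det; ring

theorem det_self_left (p q : Pt) : det p q p = 0 := by
  simp [det]

/-- Grassmann–Plücker relation for the directions from `t` to four other points. -/
theorem det_mul_det (t a b c d : Pt) :
    det t a c * det t b d = det t a b * det t c d + det t a d * det t b c := by
  unfold det; ring

theorem det_swap (t a b : Pt) : det t b a = -det t a b := by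
  unfold det; ring

/-- Around `t`, if `a, b, c` occur in this order in a half-plane starting at `s`,
then `c` comes after `a`. -/
theorem Ccw.trans {t s a b c : Pt} (ha : Ccw t s a) (hb : Ccw t s b) (hc : Ccw t s c)
    (hab : Ccw t a b) (hbc : Ccw t b c) : Ccw t a c := by
  unfold Ccw at *
  have key := det_mul_det t s a b c
  have : 0 < det t s b * det t a c := by
    have := mul_pos ha hbc
    have := mul_pos hc hab
    linarith
  exact (mul_pos_iff_of_pos_left hb).1 this

/-- Around `t`, if `a, b, c` occur in this order in a half-plane ending at `s`,
then `c` comes after `a`. -/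
theorem Ccw.trans' {t s a b c : Pt} (ha : Ccw t a s) (hb : Ccw t b s) (hc : Ccw t c s)
    (hab : Ccw t a b) (hbc : Ccw t b c) : Ccw t a c := by
  unfold Ccw at *
  have key := det_mul_det t a b c s
  have : 0 < det t a c * det t b s := by
    have := mul_pos hab hc
    have := mul_pos ha hbc
    linarith
  exact (mul_pos_iff_of_pos_right hb).1 this

/-- If `t` is surrounded by `a, b, c` and `d` comes after both `a` and `b`,
then `d` comes before `c`. -/
theorem Ccw.of_cycle_right {t a b c d : Pt} (hab : Ccw t a b) (hbc : Ccw t b c)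
    (hca : Ccw t c a) (had : Ccw t a d) (hbd : Ccw t b d) : Ccw t d c := by
  unfold Ccw at *
  have key := det_mul_det t a b d c
  rw [det_swap t c a] at key
  have : 0 < det t a b * det t d c := by nlinarith [mul_pos had hbc, mul_pos hca hbd]
  exact (mul_pos_iff_of_pos_left hab).1 this

/-- If `t` is surrounded by `a, b, c` and `d` comes before both `b` and `c`,
then `d` comes after `a`. -/
theorem Ccw.of_cycle_left {t a b c d : Pt} (hab : Ccw t a b) (hbc : Ccw t b c)
    (hca : Ccw t c a) (hdb : Ccw t d b) (hdc : Ccw t d c) : Ccw t a d := by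
  unfold Ccw at *
  have key := det_mul_det t a d b c
  rw [det_swap t c a] at key
  have : 0 < det t a d * det t b c := by nlinarith [mul_pos hab hdc, mul_pos hca hdb]
  exact (mul_pos_iff_of_pos_right hbc).1 this

theorem Ccw.mem_convexHull {a b c p : Pt} (hab : Ccw a b p) (hbc : Ccw b c p)
    (hca : Ccw c a p) : p ∈ convexHull ℝ ({a, b, c} : Set Pt) := by
  unfold Ccw at *
  set s := det a b p + det b c p + det c a p with hs
  have hpos : 0 < s := by positivity
  rw [convexHull_insert (by simp), convexHull_pair]
  simp only [mem_convexJoin, Set.mem_singleton_iff, exists_eq_left]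
  have hd : 0 < det a b p + det c a p := by positivity
  refine ⟨(det c a p / (det a b p + det c a p)) • b + (det a b p / (det a b p + det c a p)) • c,
    ⟨_, _, by positivity, by positivity, by field_simp; ring, rfl⟩,
    ⟨det b c p / s, (det a b p + det c a p) / s, by positivity, by positivity,
      by field_simp; rw [hs]; ring, ?_⟩⟩
  ext <;> simp <;> field_simp <;> rw [hs] <;> unfold det <;> ring

/-- The closed left half-plane of a directed line is convex. -/
theorem convex_det_nonneg (u v : Pt) : Convex ℝ {p | 0 ≤ det u v p} := by
  intro p hp q hq s t hs ht hst
  simp only [Set.mem_ofPred_eq] at *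
  have : det u v (s • p + t • q) = s * det u v p + t * det u v q := by
    obtain rfl : s = 1 - t := by linarith
    simp [det]; ring
  rw [this]; positivity

theorem det_nonneg_of_mem_convexHull {u v p : Pt} {T : Set Pt} (hT : ∀ q ∈ T, 0 ≤ det u v q)
    (hp : p ∈ convexHull ℝ T) : 0 ≤ det u v p :=
  convexHull_min hT (convex_det_nonneg u v) hp

theorem ccw_of_mem_interior_convexHull {u v p : Pt} {T : Set Pt} (huv : u ≠ v)
    (hT : ∀ q ∈ T, 0 ≤ det u v q) (hp : p ∈ interior (convexHull ℝ T)) : Ccw u v p := by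
  have hc : ContinuousAt (fun t : ℝ => p + t • ((v.2 - u.2, u.1 - v.1) : Pt)) 0 := by fun_prop
  have hev := hc.eventually (p := fun q => q ∈ convexHull ℝ T)
    (by simpa using mem_interior_iff_mem_nhds.1 hp)
  obtain ⟨ε, hε, h⟩ := Metric.eventually_nhds_iff.1 hev
  have h2 := det_nonneg_of_mem_convexHull hT (h (y := ε / 2)
    (by rw [Real.dist_eq, sub_zero, abs_of_pos (by positivity)]; linarith))
  have h3 : det u v (p + (ε / 2) • ((v.2 - u.2, u.1 - v.1) : Pt)) =
      det u v p - ε / 2 * ((v.1 - u.1) ^ 2 + (v.2 - u.2) ^ 2) := by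
    simp [det]; ring
  have h4 : 0 < (v.1 - u.1) ^ 2 + (v.2 - u.2) ^ 2 := by
    by_contra! hle
    apply huv
    ext <;> nlinarith [sq_nonneg (v.1 - u.1), sq_nonneg (v.2 - u.2)]
  have : 0 < ε / 2 * ((v.1 - u.1) ^ 2 + (v.2 - u.2) ^ 2) := by positivity
  unfold Ccw; linarith

theorem notMem_convexHull_of_det_neg {u v p : Pt} {T : Set Pt} (hT : ∀ q ∈ T, 0 ≤ det u v q)
    (hp : Ccw v u p) : p ∉ convexHull ℝ T := fun h =>
  absurd (det_nonneg_of_mem_convexHull hT h) (not_le.2 hp.det_neg)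

/-- All triples of `a, b, c, d, e`, in this order, are counterclockwise. -/
structure ConvexPent (a b c d e : Pt) : Prop where
  abc : Ccw a b c
  abd : Ccw a b d
  abe : Ccw a b e
  acd : Ccw a c d
  ace : Ccw a c e
  ade : Ccw a d e
  bcd : Ccw b c d
  bce : Ccw b c e
  bde : Ccw b d e
  cde : Ccw c d e

namespace ConvexPent

variable {a b c d e p : Pt}

theorem of_fan_left (abc : Ccw a b c) (abd : Ccw a b d) (abe : Ccw a b e) (acd : Ccw a c d)
    (ade : Ccw a d e) (bcd : Ccw b c d) (cde : Ccw c d e) : ConvexPent a b c d e :=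
  have ace : Ccw a c e := abc.trans abd abe acd ade
  { abc, abd, abe, acd, ace, ade, bcd, cde
    bce := (cde.trans acd.rot bcd.rot ace.rot abc.rot.rot).rot.rot
    bde := (cde.rot.trans' acd.rot.rot bcd.rot.rot ade.rot abd.rot.rot).rot.rot }

theorem of_fan_right (abc : Ccw a b c) (abd : Ccw a b d) (abe : Ccw a b e) (bcd : Ccw b c d)
    (bde : Ccw b d e) (ade : Ccw a d e) (cde : Ccw c d e) : ConvexPent a b c d e :=
  have bce : Ccw b c e := abc.rot.trans' abd.rot abe.rot bcd bde
  { abc, abd, abe, bcd, bce, bde, ade, cde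
    ace := (ade.rot.rot.trans' bde.rot.rot cde.rot.rot abe.rot.rot bce.rot.rot).rot
    acd := (ade.rot.trans bde.rot cde.rot abd.rot.rot bcd.rot.rot).rot }

theorem rotate (h : ConvexPent a b c d e) : ConvexPent b c d e a :=
  ⟨h.bcd, h.bce, h.abc.rot, h.bde, h.abd.rot, h.abe.rot, h.cde, h.acd.rot, h.ace.rot, h.ade.rot⟩

theorem subset_halfPlane (h : ConvexPent a b c d e) :
    ∀ q ∈ ({a, b, c, d, e} : Set Pt), 0 ≤ det a b q := by
  rintro q (rfl | rfl | rfl | rfl | rfl)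
  exacts [(det_self_left _ _).ge, (det_self_right _ _).ge, h.abc.le, h.abd.le, h.abe.le]

theorem set_rotate : ({b, c, d, e, a} : Set Pt) = {a, b, c, d, e} := by
  ext; simp only [Set.mem_insert_iff, Set.mem_singleton_iff]; tauto

theorem out_ab (h : ConvexPent a b c d e) (hp : Ccw b a p) :
    p ∉ interior (convexHull ℝ ({a, b, c, d, e} : Set Pt)) := fun hi =>
  notMem_convexHull_of_det_neg h.subset_halfPlane hp (interior_subset hi)

theorem out_bc (h : ConvexPent a b c d e) (hp : Ccw c b p) :
    p ∉ interior (convexHull ℝ ({a, b, c, d, e} : Set Pt)) :=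
  set_rotate ▸ h.rotate.out_ab hp

theorem out_cd (h : ConvexPent a b c d e) (hp : Ccw d c p) :
    p ∉ interior (convexHull ℝ ({a, b, c, d, e} : Set Pt)) :=
  set_rotate ▸ h.rotate.out_bc hp

theorem out_de (h : ConvexPent a b c d e) (hp : Ccw e d p) :
    p ∉ interior (convexHull ℝ ({a, b, c, d, e} : Set Pt)) :=
  set_rotate ▸ h.rotate.out_cd hp

theorem out_ea (h : ConvexPent a b c d e) (hp : Ccw a e p) :
    p ∉ interior (convexHull ℝ ({a, b, c, d, e} : Set Pt)) :=
  set_rotate ▸ h.rotate.out_de hp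

end ConvexPent

namespace ConvexPent

variable {a b c d e p : Pt}

theorem notMem_convexHull (h : ConvexPent a b c d e) :
    a ∉ convexHull ℝ ({b, c, d, e} : Set Pt) := by
  refine notMem_convexHull_of_det_neg (u := e) (v := b) ?_ h.abe.rot
  rintro q (rfl | rfl | rfl | rfl)
  exacts [(det_self_right _ _).ge, h.bce.rot.rot.le, h.bde.rot.rot.le, (det_self_left _ _).ge]

theorem card_eq_five (h : ConvexPent a b c d e) : ({a, b, c, d, e} : Finset Pt).card = 5 := by
  have h1 := h.abc.ne
  have h2 := h.abc.rot.ne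
  have h3 := h.abc.rot.rot.ne.symm
  have h4 := h.abd.rot.rot.ne.symm
  have h5 := h.abe.rot.rot.ne.symm
  have h6 := h.abd.rot.ne
  have h7 := h.abe.rot.ne
  have h8 := h.cde.ne
  have h9 := h.cde.rot.ne
  have h10 := h.cde.rot.rot.ne.symm
  simp [*]

theorem convexPos (h : ConvexPent a b c d e) : ConvexPos {a, b, c, d, e} := by
  have key : ∀ {a b c d e : Pt}, ConvexPent a b c d e → ∀ T : Set Pt,
      (∀ q ∈ T, q = a ∨ q = b ∨ q = c ∨ q = d ∨ q = e) → a ∉ convexHull ℝ (T \ {a}) := by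
    intro a b c d e h T hT ha
    refine h.notMem_convexHull (convexHull_mono ?_ ha)
    rintro q ⟨hq, hqa⟩
    simpa [show q ≠ a from hqa] using hT q hq
  intro p hp
  rw [Finset.coe_erase]
  have hT : ∀ q ∈ (({a, b, c, d, e} : Finset Pt) : Set Pt),
    q = a ∨ q = b ∨ q = c ∨ q = d ∨ q = e := by simp
  simp only [Finset.mem_insert, Finset.mem_singleton] at hp
  rcases hp with rfl | rfl | rfl | rfl | rfl
  · exact key h _ hT
  · exact key h.rotate _ fun q hq => by have := hT q hq; tauto
  · exact key h.rotate.rotate _ fun q hq => by have := hT q hq; tauto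
  · exact key h.rotate.rotate.rotate _ fun q hq => by have := hT q hq; tauto
  · exact key h.rotate.rotate.rotate.rotate _ fun q hq => by have := hT q hq; tauto

theorem exists_emptyConvexPentagon {P : Finset Pt} {w x y z : Pt} (h : ConvexPent a b c d e)
    (hP : ∀ p, p ∈ P ↔ p = a ∨ p = b ∨ p = c ∨ p = d ∨ p = e ∨ p = w ∨ p = x ∨ p = y ∨ p = z)
    (hw : w ∉ interior (convexHull ℝ ({a, b, c, d, e} : Set Pt)))
    (hx : x ∉ interior (convexHull ℝ ({a, b, c, d, e} : Set Pt)))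
    (hy : y ∉ interior (convexHull ℝ ({a, b, c, d, e} : Set Pt)))
    (hz : z ∉ interior (convexHull ℝ ({a, b, c, d, e} : Set Pt))) :
    ∃ S, EmptyConvexPentagon P S := by
  refine ⟨{a, b, c, d, e}, ?_, h.card_eq_five, h.convexPos, ?_⟩
  · intro p hp
    simp only [Finset.mem_insert, Finset.mem_singleton] at hp
    rw [hP]
    tauto
  · intro p hp hpS
    simp only [Finset.mem_insert, Finset.mem_singleton, not_or] at hpS
    simp only [Finset.coe_insert, Finset.coe_singleton]
    rw [hP] at hp
    rcases hp with hp | hp | hp | hp | hp | rfl | rfl | rfl | rfl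
    · exact absurd hp hpS.1
    · exact absurd hp hpS.2.1
    · exact absurd hp hpS.2.2.1
    · exact absurd hp hpS.2.2.2.1
    · exact absurd hp hpS.2.2.2.2
    all_goals assumption

end ConvexPent

/-- `P` consists of the nine distinct points `a, …, i`, no three of them on a line. -/
structure Nine (P : Finset Pt) (a b c d e f g h i : Pt) : Prop where
  mem : ∀ p, p ∈ P ↔
    p = a ∨ p = b ∨ p = c ∨ p = d ∨ p = e ∨ p = f ∨ p = g ∨ p = h ∨ p = i
  nodup : [a, b, c, d, e, f, g, h, i].Nodup
  gen : ∀ p ∈ P, ∀ q ∈ P, ∀ r ∈ P, p ≠ q → p ≠ r → q ≠ r → Ccw p q r ∨ Ccw p r q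

namespace Nine

variable {P : Finset Pt} {a b c d e f g h i : Pt}

theorem sign (N : Nine P a b c d e f g h i) (p q r : Pt)
    (H : [a, b, c, d, e, f, g, h, i].Nodup → (p ∈ [a, b, c, d, e, f, g, h, i] ∧
      q ∈ [a, b, c, d, e, f, g, h, i] ∧ r ∈ [a, b, c, d, e, f, g, h, i]) ∧
      p ≠ q ∧ p ≠ r ∧ q ≠ r := by
        simp +contextual [eq_comm]) :
    Ccw p q r ∨ Ccw p r q := by
  obtain ⟨⟨hp, hq, hr⟩, h1, h2, h3⟩ := H N.nodup
  simp only [List.mem_cons, List.not_mem_nil, or_false, ← N.mem] at hp hq hr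
  exact N.gen p hp q hq r hr h1 h2 h3

theorem perm {a₁ b₁ c₁ d₁ e₁ f₁ g₁ h₁ i₁ : Pt} (N : Nine P a b c d e f g h i)
    (hp : [a, b, c, d, e, f, g, h, i].Perm [a₁, b₁, c₁, d₁, e₁, f₁, g₁, h₁, i₁] := by
      rw [← Multiset.coe_eq_coe]
      simp only [← Multiset.cons_coe, Multiset.coe_nil, ← Multiset.singleton_add]
      abel) :
    Nine P a₁ b₁ c₁ d₁ e₁ f₁ g₁ h₁ i₁ where
  mem p := by
    rw [N.mem]
    simpa using hp.mem_iff (a := p)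
  nodup := hp.nodup_iff.1 N.nodup
  gen := N.gen

theorem exists_pentagon {a₁ b₁ c₁ d₁ e₁ f₁ g₁ h₁ i₁ : Pt} (N : Nine P a b c d e f g h i)
    (hc : ConvexPent a₁ b₁ c₁ d₁ e₁)
    (hf : f₁ ∉ interior (convexHull ℝ ({a₁, b₁, c₁, d₁, e₁} : Set Pt)))
    (hg : g₁ ∉ interior (convexHull ℝ ({a₁, b₁, c₁, d₁, e₁} : Set Pt)))
    (hh : h₁ ∉ interior (convexHull ℝ ({a₁, b₁, c₁, d₁, e₁} : Set Pt)))
    (hi : i₁ ∉ interior (convexHull ℝ ({a₁, b₁, c₁, d₁, e₁} : Set Pt)))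
    (hp : [a, b, c, d, e, f, g, h, i].Perm [a₁, b₁, c₁, d₁, e₁, f₁, g₁, h₁, i₁] := by
      rw [← Multiset.coe_eq_coe]
      simp only [← Multiset.cons_coe, Multiset.coe_nil, ← Multiset.singleton_add]
      abel) :
    ∃ S, EmptyConvexPentagon P S :=
  hc.exists_emptyConvexPentagon (N.perm hp).mem hf hg hh hi

/-- A point outside the hull of all points but itself and the last one is in no triangle. -/
theorem not_surrounded (N : Nine P a b c d e f g h i) {p q r y : Pt}
    (hy : y ∉ convexHull ℝ ((P : Set Pt) \ {y, i})) (hpq : Ccw p q y) (hqr : Ccw q r y)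
    (hrp : Ccw r p y)
    (H : [a, b, c, d, e, f, g, h, i].Nodup → p ∈ [a, b, c, d, e, f, g, h] ∧
      q ∈ [a, b, c, d, e, f, g, h] ∧ r ∈ [a, b, c, d, e, f, g, h] := by
        simp +contextual [eq_comm]) : False := by
  have hi : i ∉ [a, b, c, d, e, f, g, h] := by
    have := (List.nodup_append (l₁ := [a, b, c, d, e, f, g, h]) (l₂ := [i])).1 N.nodup
    intro h
    exact this.2.2 i h i (by simp) rfl
  have key : ∀ s ∈ [a, b, c, d, e, f, g, h], s ≠ y → s ∈ (P : Set Pt) \ {y, i} := by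
    intro s hs hsy
    refine ⟨?_, ?_⟩
    · rw [Finset.mem_coe, N.mem]
      simp only [List.mem_cons, List.not_mem_nil, or_false] at hs
      tauto
    · rintro (rfl | rfl)
      exacts [hsy rfl, hi hs]
  obtain ⟨hp, hq, hr⟩ := H N.nodup
  refine hy (convexHull_mono ?_ (hpq.mem_convexHull hqr hrp))
  rintro s (rfl | rfl | rfl)
  exacts [key _ hp hrp.rot.ne, key _ hq hpq.rot.ne, key _ hr hqr.rot.ne]

end Nine

namespace ConvexPent

variable {a b c d e p : Pt}

theorem in_ab (h : ConvexPent a b c d e)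
    (hp : p ∈ interior (convexHull ℝ ({a, b, c, d, e} : Set Pt))) : Ccw a b p :=
  ccw_of_mem_interior_convexHull h.abc.ne h.subset_halfPlane hp

theorem in_bc (h : ConvexPent a b c d e)
    (hp : p ∈ interior (convexHull ℝ ({a, b, c, d, e} : Set Pt))) : Ccw b c p :=
  h.rotate.in_ab (by rwa [set_rotate])

theorem in_cd (h : ConvexPent a b c d e)
    (hp : p ∈ interior (convexHull ℝ ({a, b, c, d, e} : Set Pt))) : Ccw c d p :=
  h.rotate.in_bc (by rwa [set_rotate])

theorem in_de (h : ConvexPent a b c d e)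
    (hp : p ∈ interior (convexHull ℝ ({a, b, c, d, e} : Set Pt))) : Ccw d e p :=
  h.rotate.in_cd (by rwa [set_rotate])

theorem in_ea (h : ConvexPent a b c d e)
    (hp : p ∈ interior (convexHull ℝ ({a, b, c, d, e} : Set Pt))) : Ccw e a p :=
  h.rotate.in_de (by rwa [set_rotate])

end ConvexPent

/-- Three extreme points beyond the side `BC` of a convex quadrilateral, sorted around `B`. -/
theorem exists_pentagon_of_three_beyond_sorted {P : Finset Pt} {A B C D U V W Y X : Pt}
    (N : Nine P A B C D U V W Y X) (abc : Ccw A B C) (bcd : Ccw B C D) (cda : Ccw C D A)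
    (dab : Ccw D A B) (cbu : Ccw C B U) (cbv : Ccw C B V) (cbw : Ccw C B W)
    (buv : Ccw B U V) (bvw : Ccw B V W)
    (hU : U ∉ convexHull ℝ ((P : Set Pt) \ {U, X}))
    (hV : V ∉ convexHull ℝ ((P : Set Pt) \ {V, X}))
    (hW : W ∉ convexHull ℝ ((P : Set Pt) \ {W, X}))
    (hY : Y ∉ convexHull ℝ ((P : Set Pt) \ {Y, X})) :
    ∃ S, EmptyConvexPentagon P S := by
  have buw : Ccw B U W := cbu.rot.trans' cbv.rot cbw.rot buv bvw
  have uvc : Ccw U V C := (N.sign U V C).resolve_right fun h =>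
    N.not_surrounded hV buv h cbv
  have vwc : Ccw V W C := (N.sign V W C).resolve_right fun h =>
    N.not_surrounded hW bvw h cbw
  have uwc : Ccw U W C := (N.sign U W C).resolve_right fun h =>
    N.not_surrounded hW buw h cbw
  have uvw : Ccw U V W := (N.sign U V W).resolve_right fun h =>
    N.not_surrounded hV buv h bvw.rot.rot
  have K : ConvexPent B U V W C :=
    ⟨buv, buw, cbu.rot, bvw, cbv.rot, cbw.rot, uvw, uvc, uwc, vwc⟩
  have hsub : ({A, B, C, D, U, V, W} : Set Pt) ⊆ (P : Set Pt) \ {Y, X} := by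
    have nd := N.nodup
    simp only [List.nodup_cons, List.mem_cons, List.not_mem_nil, or_false, not_or] at nd
    rintro s (rfl | rfl | rfl | rfl | rfl | rfl | rfl) <;>
      exact ⟨by simp [N.mem], by simp; tauto⟩
  by_cases hX : X ∈ interior (convexHull ℝ ({B, U, V, W, C} : Set Pt))
  swap
  · refine N.exists_pentagon K (K.out_ea abc.rot) (K.out_ea bcd)
      (fun h => hY (convexHull_mono (subset_trans ?_ hsub) (interior_subset h))) hX
    simp [Set.insert_subset_iff]
  have hY' : ∀ S ⊆ ({A, B, C, D, U, V, W, X} : Set Pt), Y ∉ interior (convexHull ℝ S) := by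
    intro S hS h
    refine hY (convexHull_min ?_ (convex_convexHull ℝ _) (interior_subset h))
    intro s hs
    have hs' := hS hs
    by_cases hsX : s = X
    · rw [hsX]
      refine convexHull_mono (subset_trans ?_ hsub) (interior_subset hX)
      simp [Set.insert_subset_iff]
    · refine subset_convexHull ℝ _ (hsub ?_)
      simp only [Set.mem_insert_iff, Set.mem_singleton_iff] at hs' ⊢
      tauto
  have bux : Ccw B U X := K.in_ab hX
  have uvx : Ccw U V X := K.in_bc hX
  have vwx : Ccw V W X := K.in_cd hX
  have wcx : Ccw W C X := K.in_de hX
  have cbx : Ccw C B X := K.in_ea hX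
  have hBC : ∀ p, Ccw B C p → ∀ S ⊆ ({B, C, U, V, W, X} : Set Pt),
      p ∉ interior (convexHull ℝ S) := by
    intro p hp S hS h
    refine notMem_convexHull_of_det_neg (u := C) (v := B) ?_ hp
      (convexHull_mono hS (interior_subset h))
    rintro q (rfl | rfl | rfl | rfl | rfl | rfl)
    exacts [(det_self_right _ _).ge, (det_self_left _ _).ge, cbu.le, cbv.le, cbw.le, cbx.le]
  rcases N.sign B V X with bvx | bxv
  swap
  · have K : ConvexPent C B X V W := .of_fan_right cbx cbv cbw bxv bvw vwc.rot.rot vwx.rot.rot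
    exact N.exists_pentagon K (K.out_ab abc.rot) (K.out_ab bcd) (K.out_bc bux.rot.rot)
      (hY' _ (by simp [Set.insert_subset_iff]))
  rcases N.sign V C X with vcx | vxc
  swap
  · have K : ConvexPent C B U V X := .of_fan_left cbu cbv cbx uvc.rot.rot vxc.rot.rot buv uvx
    exact N.exists_pentagon K (K.out_ab abc.rot) (K.out_ab bcd) (K.out_ea wcx.rot)
      (hY' _ (by simp [Set.insert_subset_iff]))
  rcases N.sign B X W with bxw | bwx
  swap
  · have K : ConvexPent B U V W X := .of_fan_left buv buw bux bvw bwx uvw vwx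
    exact N.exists_pentagon K (hBC A abc.rot _ (by simp [Set.insert_subset_iff]))
      (hBC D bcd _ (by simp [Set.insert_subset_iff])) (K.out_de wcx.rot.rot)
      (hY' _ (by simp [Set.insert_subset_iff]))
  rcases N.sign C U X with cux | cxu
  swap
  · have K : ConvexPent W C X U V :=
      .of_fan_right wcx uwc.rot vwc.rot cxu uvc.rot.rot uvw.rot.rot uvx.rot.rot
    exact N.exists_pentagon K (hBC A abc.rot _ (by simp [Set.insert_subset_iff]))
      (hBC D bcd _ (by simp [Set.insert_subset_iff])) (K.out_cd bux.rot)
      (hY' _ (by simp [Set.insert_subset_iff]))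
  rcases N.sign A B X with abx | axb
  · rcases N.sign C D X with cdx | cxd
    · have K : ConvexPent C D A B X := .of_fan_left cda bcd.rot cdx abc.rot.rot cbx dab abx
      exact N.exists_pentagon K (K.out_de bux.rot.rot) (K.out_de bvx.rot.rot)
        (K.out_ea wcx.rot) (hY' _ (by simp [Set.insert_subset_iff]))
    · have cvd : Ccw C V D := cbx.of_cycle_right cxd bcd.rot cbv vcx.rot
      have cwd : Ccw C W D := cbx.of_cycle_right cxd bcd.rot cbw wcx.rot
      have dvw : Ccw D V W := (N.sign D V W).resolve_right fun h =>
        N.not_surrounded hW vwc.rot.rot h.rot.rot cwd.rot.rot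
      have K : ConvexPent D C X V W :=
        .of_fan_right cxd.rot.rot cvd.rot.rot cwd.rot.rot vcx.rot vwc.rot.rot dvw vwx.rot.rot
      exact N.exists_pentagon K (K.out_ab cda) (K.out_ab bcd.rot) (K.out_bc cux.rot.rot)
        (hY' _ (by simp [Set.insert_subset_iff]))
  · have bav : Ccw B A V := axb.rot.rot.of_cycle_left cbx.rot abc.rot bvx cbv.rot
    have bau : Ccw B A U := axb.rot.rot.of_cycle_left cbx.rot abc.rot bux cbu.rot
    have auv : Ccw A U V := (N.sign A U V).resolve_right fun h =>
      N.not_surrounded hU bau h buv.rot.rot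
    have K : ConvexPent B A U V X := .of_fan_left bau bav axb.rot.rot buv bvx auv uvx
    exact N.exists_pentagon K (K.out_ab abc) (K.out_ab dab.rot) (K.out_ea bxw)
      (hY' _ (by simp [Set.insert_subset_iff]))

/-- Three extreme points beyond the side `BC` of a convex quadrilateral. -/
theorem exists_pentagon_of_three_beyond {P : Finset Pt} {A B C D U V W Y X : Pt}
    (N : Nine P A B C D U V W Y X) (abc : Ccw A B C) (bcd : Ccw B C D) (cda : Ccw C D A)
    (dab : Ccw D A B) (cbu : Ccw C B U) (cbv : Ccw C B V) (cbw : Ccw C B W)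
    (hU : U ∉ convexHull ℝ ((P : Set Pt) \ {U, X}))
    (hV : V ∉ convexHull ℝ ((P : Set Pt) \ {V, X}))
    (hW : W ∉ convexHull ℝ ((P : Set Pt) \ {W, X}))
    (hY : Y ∉ convexHull ℝ ((P : Set Pt) \ {Y, X})) :
    ∃ S, EmptyConvexPentagon P S := by
  rcases N.sign B U V with uv | vu <;> rcases N.sign B V W with vw | wv <;>
    rcases N.sign B U W with uw | wu
  · exact exists_pentagon_of_three_beyond_sorted N abc bcd cda dab cbu cbv cbw uv vw hU hV hW hY
  · exact (wu.not_swap (cbu.rot.trans' cbv.rot cbw.rot uv vw)).elim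
  · exact exists_pentagon_of_three_beyond_sorted (N.perm : Nine P A B C D U W V Y X)
      abc bcd cda dab cbu cbw cbv uw wv hU hW hV hY
  · exact exists_pentagon_of_three_beyond_sorted (N.perm : Nine P A B C D W U V Y X)
      abc bcd cda dab cbw cbu cbv wu uv hW hU hV hY
  · exact exists_pentagon_of_three_beyond_sorted (N.perm : Nine P A B C D V U W Y X)
      abc bcd cda dab cbv cbu cbw vu uw hV hU hW hY
  · exact exists_pentagon_of_three_beyond_sorted (N.perm : Nine P A B C D V W U Y X)
      abc bcd cda dab cbv cbw cbu vw wu hV hW hU hY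
  · exact (uw.not_swap (cbw.rot.trans' cbv.rot cbu.rot wv vu)).elim
  · exact exists_pentagon_of_three_beyond_sorted (N.perm : Nine P A B C D W V U Y X)
      abc bcd cda dab cbw cbv cbu wv vu hW hV hU hY

/-- A counterclockwise convex quadrilateral `ABCD` with extreme points `E, F, G, H` beyond its
vertices `A, B, C, D`, and a further point `X`. -/
structure Frame (P : Finset Pt) (A B C D E F G H X : Pt) : Prop
    extends Nine P A B C D E F G H X where
  abc : Ccw A B C
  bcd : Ccw B C D
  cda : Ccw C D A
  dab : Ccw D A B
  bae : Ccw B A E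
  ade : Ccw A D E
  cbf : Ccw C B F
  baf : Ccw B A F
  dcg : Ccw D C G
  cbg : Ccw C B G
  adh : Ccw A D H
  dch : Ccw D C H
  extreme_e : E ∉ convexHull ℝ ((P : Set Pt) \ {E, X})
  extreme_f : F ∉ convexHull ℝ ((P : Set Pt) \ {F, X})
  extreme_g : G ∉ convexHull ℝ ((P : Set Pt) \ {G, X})
  extreme_h : H ∉ convexHull ℝ ((P : Set Pt) \ {H, X})
  hull_a : A ∈ convexHull ℝ ({E, F, G, H} : Set Pt)
  hull_b : B ∈ convexHull ℝ ({E, F, G, H} : Set Pt)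
  hull_c : C ∈ convexHull ℝ ({E, F, G, H} : Set Pt)
  hull_d : D ∈ convexHull ℝ ({E, F, G, H} : Set Pt)

namespace Frame

variable {P : Finset Pt} {A B C D E F G H X : Pt}

theorem rotate (Q : Frame P A B C D E F G H X) : Frame P B C D A F G H E X := by
  have hs : ({F, G, H, E} : Set Pt) = {E, F, G, H} := by
    ext; simp only [Set.mem_insert_iff, Set.mem_singleton_iff]; tauto
  exact ⟨Q.perm, Q.bcd, Q.cda, Q.dab, Q.abc, Q.cbf, Q.baf, Q.dcg, Q.cbg, Q.adh, Q.dch, Q.bae,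
    Q.ade, Q.extreme_f, Q.extreme_g, Q.extreme_h, Q.extreme_e, hs ▸ Q.hull_b, hs ▸ Q.hull_c,
    hs ▸ Q.hull_d, hs ▸ Q.hull_a⟩

theorem bce (Q : Frame P A B C D E F G H X) (hno : ¬∃ S, EmptyConvexPentagon P S) :
    Ccw B C E :=
  (Q.sign B C E).resolve_right fun h => hno <|
    exists_pentagon_of_three_beyond Q.toNine Q.abc Q.bcd Q.cda Q.dab h.rot.rot Q.cbf Q.cbg
      Q.extreme_e Q.extreme_f Q.extreme_g Q.extreme_h

theorem bch (Q : Frame P A B C D E F G H X) (hno : ¬∃ S, EmptyConvexPentagon P S) :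
    Ccw B C H :=
  (Q.sign B C H).resolve_right fun h => hno <|
    exists_pentagon_of_three_beyond (Q.perm : Nine P A B C D F G H E X) Q.abc Q.bcd Q.cda Q.dab
      Q.cbf Q.cbg h.rot.rot Q.extreme_f Q.extreme_g Q.extreme_h Q.extreme_e

theorem efg (Q : Frame P A B C D E F G H X) (hno : ¬∃ S, EmptyConvexPentagon P S) :
    Ccw E F G := by
  have abg : Ccw A B G := Q.rotate.rotate.rotate.bch hno
  have bef : Ccw B E F :=
    Q.abc.rot.of_cycle_right Q.baf Q.cbf.rot (Q.bce hno) Q.bae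
  have bfg : Ccw B F G := Q.cbf.rot.of_cycle_left Q.abc.rot Q.baf Q.cbg.rot abg.rot
  exact (Q.sign E F G).resolve_right fun h =>
    Q.not_surrounded Q.extreme_f bef h bfg.rot.rot

theorem ccw_of_mem_hull (Q : Frame P A B C D E F G H X) (hno : ¬∃ S, EmptyConvexPentagon P S)
    {q : Pt} (hq : q ∈ convexHull ℝ ({E, F, G, H} : Set Pt)) (hs : Ccw E F q ∨ Ccw E q F) :
    Ccw E F q := by
  refine hs.resolve_right fun h => notMem_convexHull_of_det_neg ?_ h.rot.rot hq
  rintro q (rfl | rfl | rfl | rfl)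
  exacts [(det_self_left _ _).ge, (det_self_right _ _).ge, (Q.efg hno).le,
    (Q.rotate.rotate.rotate.efg hno).rot.le]

theorem efa (Q : Frame P A B C D E F G H X) (hno : ¬∃ S, EmptyConvexPentagon P S) :
    Ccw E F A :=
  Q.ccw_of_mem_hull hno Q.hull_a (Q.sign E F A)

theorem efb (Q : Frame P A B C D E F G H X) (hno : ¬∃ S, EmptyConvexPentagon P S) :
    Ccw E F B :=
  Q.ccw_of_mem_hull hno Q.hull_b (Q.sign E F B)

end Frame

/-- The orientations in a configuration of eight points without empty convex pentagons, in which
`E, F, G, H` are the extreme points and lie beyond the vertices of the quadrilateral `ABCD`. -/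
structure Corona (P : Finset Pt) (A B C D E F G H X : Pt) : Prop
    extends Nine P A B C D E F G H X where
  abc : Ccw A B C
  bcd : Ccw B C D
  cda : Ccw C D A
  dab : Ccw D A B
  bae : Ccw B A E
  ade : Ccw A D E
  cbf : Ccw C B F
  baf : Ccw B A F
  dcg : Ccw D C G
  cbg : Ccw C B G
  adh : Ccw A D H
  dch : Ccw D C H
  abg : Ccw A B G
  abh : Ccw A B H
  bce : Ccw B C E
  bch : Ccw B C H
  cde : Ccw C D E
  cdf : Ccw C D F
  daf : Ccw D A F
  dag : Ccw D A G
  efg : Ccw E F G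
  fgh : Ccw F G H
  ghe : Ccw G H E
  hef : Ccw H E F
  efa : Ccw E F A
  efb : Ccw E F B
  fgb : Ccw F G B
  fgc : Ccw F G C
  ghc : Ccw G H C
  ghd : Ccw G H D
  hed : Ccw H E D
  hea : Ccw H E A

namespace Corona

variable {P : Finset Pt} {A B C D E F G H X : Pt}

theorem rotate (Q : Corona P A B C D E F G H X) : Corona P B C D A F G H E X :=
  ⟨Q.perm, Q.bcd, Q.cda, Q.dab, Q.abc, Q.cbf, Q.baf, Q.dcg, Q.cbg, Q.adh, Q.dch, Q.bae, Q.ade,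
    Q.bch, Q.bce, Q.cdf, Q.cde, Q.daf, Q.dag, Q.abg, Q.abh, Q.fgh, Q.ghe, Q.hef, Q.efg, Q.fgb,
    Q.fgc, Q.ghc, Q.ghd, Q.hed, Q.hea, Q.efa, Q.efb⟩

/-- If `X` is beyond `EF` and left of `EA`, then it gives a pentagon or is also beyond `HE` and
left of `HD`. -/
theorem left_step (Q : Corona P A B C D E F G H X) (fex : Ccw F E X) (eax : Ccw E A X) :
    (∃ S, EmptyConvexPentagon P S) ∨ Ccw E H X ∧ Ccw H D X := by
  have ehx : Ccw E H X := Q.efa.of_cycle_right eax fex.rot Q.hef.rot Q.hea.rot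
  rcases Q.sign H D X with hdx | hxd
  · exact .inr ⟨ehx, hdx⟩
  · left
    have dhx : Ccw D H X := hxd.rot.rot
    have K : ConvexPent E A D H X :=
      .of_fan_left Q.ade.rot.rot Q.hea.rot eax Q.hed.rot ehx Q.adh dhx
    exact Q.exists_pentagon K (K.out_bc Q.dab) (K.out_bc Q.cda.rot) (K.out_ab Q.efa.rot.rot)
      (K.out_cd Q.ghd.rot)

/-- If `X` is beyond `EF` and left of `BF`, then it gives a pentagon or is also beyond `FG` and
left of `CG`. -/
theorem right_step (Q : Corona P A B C D E F G H X) (fex : Ccw F E X) (bfx : Ccw B F X) :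
    (∃ S, EmptyConvexPentagon P S) ∨ Ccw G F X ∧ Ccw C G X := by
  have gfx : Ccw G F X :=
    (bfx.rot.of_cycle_left Q.efb.rot fex Q.fgb Q.efg.rot).rot.rot
  rcases Q.sign C G X with cgx | cxg
  · exact .inr ⟨gfx, cgx⟩
  · left
    have xgc : Ccw X G C := cxg.rot
    have K : ConvexPent B F X G C :=
      .of_fan_right bfx Q.fgb.rot.rot Q.cbf.rot gfx.rot Q.fgc Q.cbg.rot xgc
    exact Q.exists_pentagon K (K.out_ea Q.abc.rot) (K.out_ea Q.bcd) (K.out_ab Q.efb.rot)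
      (K.out_de Q.ghc.rot.rot)

theorem exists_pentagon_of_beyond_middle (Q : Corona P A B C D E F G H X) (fex : Ccw F E X)
    (aex : Ccw A E X) (fbx : Ccw F B X) :
    ∃ S, EmptyConvexPentagon P S := by
  have K : ConvexPent A E X F B :=
    .of_fan_right aex Q.efa.rot.rot Q.bae.rot fex.rot Q.efb Q.baf.rot fbx.rot.rot
  exact Q.exists_pentagon K (K.out_ea Q.abc) (K.out_ea Q.dab.rot) (K.out_de Q.fgb.rot.rot)
    (K.out_ab Q.hea.rot)

theorem exists_pentagon_of_across_side (Q : Corona P A B C D E F G H X) (bax : Ccw B A X)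
    (dax : Ccw D A X) (bcx : Ccw B C X) :
    ∃ S, EmptyConvexPentagon P S := by
  have K : ConvexPent B C D A X :=
    .of_fan_left Q.bcd Q.abc.rot bcx Q.dab.rot.rot bax Q.cda dax
  exact Q.exists_pentagon K (K.out_cd Q.ade) (K.out_ab Q.cbf) (K.out_ab Q.cbg) (K.out_cd Q.adh)

theorem exists_pentagon_of_across_corner (Q : Corona P A B C D E F G H X) (bax : Ccw B A X)
    (adx : Ccw A D X) (efx : Ccw E F X) (hex : Ccw H E X) :
    ∃ S, EmptyConvexPentagon P S := by
  rcases Q.sign A E X with aex | axe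
  · have K : ConvexPent A D H E X :=
      .of_fan_left Q.adh Q.ade adx Q.hea.rot.rot aex Q.hed.rot.rot hex
    exact Q.exists_pentagon K (K.out_ab Q.dab) (K.out_ab Q.cda.rot) (K.out_de efx.rot.rot)
      (K.out_bc Q.ghd.rot)
  · have K : ConvexPent E F B A X :=
      .of_fan_left Q.efb Q.efa efx Q.bae.rot.rot axe.rot.rot Q.baf.rot.rot bax
    exact Q.exists_pentagon K (K.out_ea hex.rot) (K.out_bc Q.fgb.rot.rot) (K.out_cd Q.abc)
      (K.out_cd Q.dab.rot)

theorem exists_pentagon_of_inner_sector (Q : Corona P A B C D E F G H X) (abx : Ccw A B X)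
    (bcx : Ccw B C X) (cdx : Ccw C D X) (dax : Ccw D A X) (acx : Ccw A C X) (bdx : Ccw B D X) :
    ∃ S, EmptyConvexPentagon P S := by
  rcases Q.sign A X E with axe | aex
  · rcases Q.sign D H X with dhx | dxh
    · have K : ConvexPent D H E A X :=
        .of_fan_left Q.hed.rot.rot Q.adh.rot dhx Q.ade.rot dax Q.hea axe.rot.rot
      exact Q.exists_pentagon K (K.out_de abx.rot.rot) (K.out_ea cdx.rot)
        (K.out_cd Q.efa.rot.rot) (K.out_ab Q.ghd.rot)
    · have K : ConvexPent D X B C H :=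
        .of_fan_left bdx.rot cdx.rot dxh Q.bcd.rot.rot Q.dch bcx.rot.rot Q.bch
      exact Q.exists_pentagon K (K.out_bc abx.rot) (K.out_ea Q.hed.rot.rot) (K.out_cd Q.cbf)
        (K.out_de Q.ghc.rot)
  · have K : ConvexPent B C X A E :=
      .of_fan_left bcx Q.abc.rot Q.bce abx.rot Q.bae acx.rot aex.rot.rot
    exact Q.exists_pentagon K (K.out_cd dax.rot) (K.out_ea Q.efb.rot.rot) (K.out_ab Q.cbg)
      (K.out_de Q.hea.rot)

theorem not_beyond_all (Q : Corona P A B C D E F G H X) (fex : Ccw F E X) (gfx : Ccw G F X)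
    (hgx : Ccw H G X) (ehx : Ccw E H X) : False := by
  have h1 := Q.efg
  have h2 := Q.ghe
  unfold Ccw det at *
  linarith

theorem exists_pentagon_of_outer (Q : Corona P A B C D E F G H X) (fex : Ccw F E X) :
    ∃ S, EmptyConvexPentagon P S := by
  by_contra hno
  rcases Q.sign E A X with eax | exa
  · obtain ⟨ehx, hdx⟩ := (Q.left_step fex eax).resolve_left hno
    have Q1 := Q.rotate.rotate.rotate
    obtain ⟨hgx, gcx⟩ := (Q1.left_step ehx hdx).resolve_left hno
    have Q2 := Q1.rotate.rotate.rotate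
    obtain ⟨gfx, -⟩ := (Q2.left_step hgx gcx).resolve_left hno
    exact Q.not_beyond_all fex gfx hgx ehx
  rcases Q.sign B F X with bfx | bxf
  · obtain ⟨gfx, cgx⟩ := (Q.right_step fex bfx).resolve_left hno
    obtain ⟨hgx, dhx⟩ := (Q.rotate.right_step gfx cgx).resolve_left hno
    obtain ⟨ehx, -⟩ := (Q.rotate.rotate.right_step hgx dhx).resolve_left hno
    exact Q.not_beyond_all fex gfx hgx ehx
  · exact hno (Q.exists_pentagon_of_beyond_middle fex exa.rot.rot bxf.rot.rot)

theorem exists_pentagon_of_across (Q : Corona P A B C D E F G H X) (bax : Ccw B A X)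
    (efx : Ccw E F X) (fgx : Ccw F G X) (hex : Ccw H E X) : ∃ S, EmptyConvexPentagon P S := by
  rcases Q.sign A D X with adx | axd
  · exact Q.exists_pentagon_of_across_corner bax adx efx hex
  rcases Q.sign B C X with bcx | bxc
  · exact Q.exists_pentagon_of_across_side bax axd.rot.rot bcx
  · exact Q.rotate.exists_pentagon_of_across_corner bxc.rot.rot bax fgx efx

theorem exists_pentagon_of_inner (Q : Corona P A B C D E F G H X) (abx : Ccw A B X)
    (bcx : Ccw B C X) (cdx : Ccw C D X) (dax : Ccw D A X) : ∃ S, EmptyConvexPentagon P S := by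
  rcases Q.sign A C X with acx | axc <;> rcases Q.sign B D X with bdx | bxd
  · exact Q.exists_pentagon_of_inner_sector abx bcx cdx dax acx bdx
  · exact Q.rotate.rotate.rotate.exists_pentagon_of_inner_sector dax abx bcx cdx bxd.rot.rot acx
  · exact Q.rotate.exists_pentagon_of_inner_sector bcx cdx dax abx bdx axc.rot.rot
  · exact Q.rotate.rotate.exists_pentagon_of_inner_sector cdx dax abx bcx axc.rot.rot bxd.rot.rot

/-- A corona of eight points with any ninth point contains an empty convex pentagon. -/
theorem exists_emptyConvexPentagon (Q : Corona P A B C D E F G H X) :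
    ∃ S, EmptyConvexPentagon P S := by
  rcases Q.sign E F X with efx | h
  swap
  · exact Q.exists_pentagon_of_outer h.rot.rot
  rcases Q.sign F G X with fgx | h
  swap
  · exact Q.rotate.exists_pentagon_of_outer h.rot.rot
  rcases Q.sign G H X with ghx | h
  swap
  · exact Q.rotate.rotate.exists_pentagon_of_outer h.rot.rot
  rcases Q.sign H E X with hex | h
  swap
  · exact Q.rotate.rotate.rotate.exists_pentagon_of_outer h.rot.rot
  rcases Q.sign A B X with abx | h
  swap
  · exact Q.exists_pentagon_of_across h.rot.rot efx fgx hex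
  rcases Q.sign B C X with bcx | h
  swap
  · exact Q.rotate.exists_pentagon_of_across h.rot.rot fgx ghx efx
  rcases Q.sign C D X with cdx | h
  swap
  · exact Q.rotate.rotate.exists_pentagon_of_across h.rot.rot ghx hex fgx
  rcases Q.sign D A X with dax | h
  swap
  · exact Q.rotate.rotate.rotate.exists_pentagon_of_across h.rot.rot hex efx ghx
  exact Q.exists_pentagon_of_inner abx bcx cdx dax

end Corona

theorem Frame.corona {P : Finset Pt} {A B C D E F G H X : Pt} (Q : Frame P A B C D E F G H X)
    (hno : ¬∃ S, EmptyConvexPentagon P S) : Corona P A B C D E F G H X where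
  toNine := Q.toNine
  abc := Q.abc
  bcd := Q.bcd
  cda := Q.cda
  dab := Q.dab
  bae := Q.bae
  ade := Q.ade
  cbf := Q.cbf
  baf := Q.baf
  dcg := Q.dcg
  cbg := Q.cbg
  adh := Q.adh
  dch := Q.dch
  abg := Q.rotate.rotate.rotate.bch hno
  abh := Q.rotate.rotate.rotate.bce hno
  bce := Q.bce hno
  bch := Q.bch hno
  cde := Q.rotate.bch hno
  cdf := Q.rotate.bce hno
  daf := Q.rotate.rotate.bch hno
  dag := Q.rotate.rotate.bce hno
  efg := Q.efg hno
  fgh := Q.rotate.efg hno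
  ghe := Q.rotate.rotate.efg hno
  hef := Q.rotate.rotate.rotate.efg hno
  efa := Q.efa hno
  efb := Q.efb hno
  fgb := Q.rotate.efa hno
  fgc := Q.rotate.efb hno
  ghc := Q.rotate.rotate.efa hno
  ghd := Q.rotate.rotate.efb hno
  hed := Q.rotate.rotate.rotate.efa hno
  hea := Q.rotate.rotate.rotate.efb hno

theorem Frame.exists_emptyConvexPentagon {P : Finset Pt} {A B C D E F G H X : Pt}
    (Q : Frame P A B C D E F G H X) : ∃ S, EmptyConvexPentagon P S := by
  by_contra hno
  exact hno (Q.corona hno).exists_emptyConvexPentagon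

/-- In a set `P` with inner layer `I` and outer layer `O`, up to the point `X`, the point `E` of the
outer layer is beyond the point `A` of the inner layer. -/
structure Beyond (P : Finset Pt) (I O : Set Pt) (X A E : Pt) : Prop where
  corner : A ∉ convexHull ℝ (I \ {A})
  beyond : E ∈ IRegion A (I \ {A})
  hull : A ∈ convexHull ℝ O
  extreme : E ∉ convexHull ℝ ((P : Set Pt) \ {E, X})

/-- A vertex `E` beyond `A` is strictly to the right of any edge line through `A`. -/
theorem Beyond.ccw_of_edge {P : Finset Pt} {I O : Set Pt} {X A E u v : Pt}
    (h : Beyond P I O X A E) (huv : u ≠ v) (hA : det u v A = 0) (hI : ∀ p ∈ I, 0 ≤ det u v p)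
    (hs : Ccw u v E ∨ Ccw u E v) : Ccw v u E := by
  rcases hs with hs | hs
  · have hT : ∀ p ∈ insert E (I \ {A}), 0 ≤ det u v p := by
      rintro p (rfl | hp)
      exacts [hs.le, hI p hp.1]
    have := ccw_of_mem_interior_convexHull huv hT h.beyond
    rw [Ccw, hA] at this
    exact this.false.elim
  · exact hs.rot.rot

section

variable {P : Finset Pt} {I O : Set Pt} {A B C D E F G H X : Pt}

theorem frame_of_beyond (N : Nine P A B C D E F G H X)
    (hI : ∀ p, p ∈ I ↔ p = A ∨ p = B ∨ p = C ∨ p = D)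
    (hO : ∀ p, p ∈ O ↔ p = E ∨ p = F ∨ p = G ∨ p = H) (a : Beyond P I O X A E)
    (b : Beyond P I O X B F) (c : Beyond P I O X C G) (d : Beyond P I O X D H)
    (abc : Ccw A B C) (bcd : Ccw B C D) (cda : Ccw C D A) (dab : Ccw D A B) :
    Frame P A B C D E F G H X := by
  have side {p q r s : Pt} (hpqr : Ccw p q r) (hpqs : Ccw p q s)
      (h : ∀ x, x ∈ I ↔ x = p ∨ x = q ∨ x = r ∨ x = s) : ∀ x ∈ I, 0 ≤ det p q x := by
    intro x hx
    rcases (h x).1 hx with rfl | rfl | rfl | rfl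
    exacts [(det_self_left _ _).ge, (det_self_right _ _).ge, hpqr.le, hpqs.le]
  have sAB := side abc dab.rot hI
  have sBC := side bcd abc.rot fun x => by rw [hI]; tauto
  have sCD := side cda bcd.rot fun x => by rw [hI]; tauto
  have sDA := side dab cda.rot fun x => by rw [hI]; tauto
  have hO' : O = {E, F, G, H} := by ext p; simp [hO]
  exact
    { toNine := N
      abc, bcd, cda, dab
      bae := a.ccw_of_edge abc.ne (det_self_left _ _) sAB (N.sign A B E)
      baf := b.ccw_of_edge abc.ne (det_self_right _ _) sAB (N.sign A B F)
      cbf := b.ccw_of_edge bcd.ne (det_self_left _ _) sBC (N.sign B C F)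
      cbg := c.ccw_of_edge bcd.ne (det_self_right _ _) sBC (N.sign B C G)
      dcg := c.ccw_of_edge cda.ne (det_self_left _ _) sCD (N.sign C D G)
      dch := d.ccw_of_edge cda.ne (det_self_right _ _) sCD (N.sign C D H)
      adh := d.ccw_of_edge dab.ne (det_self_left _ _) sDA (N.sign D A H)
      ade := a.ccw_of_edge dab.ne (det_self_right _ _) sDA (N.sign D A E)
      extreme_e := a.extreme
      extreme_f := b.extreme
      extreme_g := c.extreme
      extreme_h := d.extreme
      hull_a := hO' ▸ a.hull
      hull_b := hO' ▸ b.hull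
      hull_c := hO' ▸ c.hull
      hull_d := hO' ▸ d.hull }

theorem exists_pentagon_of_beyond_of_ccw (N : Nine P A B C D E F G H X)
    (hI : ∀ p, p ∈ I ↔ p = A ∨ p = B ∨ p = C ∨ p = D)
    (hO : ∀ p, p ∈ O ↔ p = E ∨ p = F ∨ p = G ∨ p = H) (a : Beyond P I O X A E)
    (b : Beyond P I O X B F) (c : Beyond P I O X C G) (d : Beyond P I O X D H)
    (abc : Ccw A B C) : ∃ S, EmptyConvexPentagon P S := by
  have tri {p q r s : Pt} (hs : s ∉ convexHull ℝ (I \ {s})) (hp : p ∈ I) (hq : q ∈ I)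
      (hr : r ∈ I) (hpq : Ccw p q s) (hqr : Ccw q r s) (hrp : Ccw r p s) : False := by
    refine hs (convexHull_mono ?_ (hpq.mem_convexHull hqr hrp))
    rintro t (rfl | rfl | rfl)
    exacts [⟨hp, hrp.rot.ne⟩, ⟨hq, hpq.rot.ne⟩, ⟨hr, hqr.rot.ne⟩]
  have hA : A ∈ I := by simp [hI]
  have hB : B ∈ I := by simp [hI]
  have hC : C ∈ I := by simp [hI]
  have hD : D ∈ I := by simp [hI]
  rcases N.sign A B D with abd | adb <;> rcases N.sign B C D with bcd | bdc <;>
    rcases N.sign C A D with cad | cda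
  · exact (tri d.corner hA hB hC abd bcd cad).elim
  · exact (frame_of_beyond N hI hO a b c d abc bcd cda abd.rot.rot).exists_emptyConvexPentagon
  · exact (frame_of_beyond (N.perm : Nine P A B D C E F H G X) (fun p => by rw [hI]; tauto)
      (fun p => by rw [hO]; tauto) a b d c abd bdc cad.rot.rot
      abc.rot.rot).exists_emptyConvexPentagon
  · exact (tri c.corner hA hB hD abc bdc cda.rot).elim
  · exact (frame_of_beyond (N.perm : Nine P A D B C E H F G X) (fun p => by rw [hI]; tauto)
      (fun p => by rw [hO]; tauto) a d b c adb bcd.rot.rot abc.rot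
      cad).exists_emptyConvexPentagon
  · exact (tri a.corner hB hC hD abc.rot cda adb.rot).elim
  · exact (tri b.corner hA hD hC adb bdc.rot abc.rot.rot).elim
  · unfold Ccw det at abc adb bdc cda
    linarith

theorem exists_pentagon_of_beyond (N : Nine P A B C D E F G H X)
    (hI : ∀ p, p ∈ I ↔ p = A ∨ p = B ∨ p = C ∨ p = D)
    (hO : ∀ p, p ∈ O ↔ p = E ∨ p = F ∨ p = G ∨ p = H) (a : Beyond P I O X A E)
    (b : Beyond P I O X B F) (c : Beyond P I O X C G) (d : Beyond P I O X D H) :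
    ∃ S, EmptyConvexPentagon P S := by
  rcases N.sign A B C with abc | acb
  · exact exists_pentagon_of_beyond_of_ccw N hI hO a b c d abc
  · exact exists_pentagon_of_beyond_of_ccw (N.perm : Nine P A C B D E G F H X)
      (fun p => by rw [hI]; tauto) (fun p => by rw [hO]; tauto) a c b d acb

end

theorem convexHull_hullVerts (S : Finset Pt) :
    convexHull ℝ (hullVerts S : Set Pt) = convexHull ℝ (S : Set Pt) := by
  refine (convexHull_mono (Finset.coe_subset.2 (Finset.filter_subset _ _))).antisymm ?_
  have hext : (convexHull ℝ (S : Set Pt)).extremePoints ℝ ⊆ hullVerts S := by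
    intro p hp
    have hpS : p ∈ S := extremePoints_convexHull_subset hp
    have h := (convex_convexHull ℝ (S : Set Pt)).mem_extremePoints_iff_mem_sdiff_convexHull_sdiff.1
      hp
    simp only [hullVerts, Finset.coe_filter, Set.mem_ofPred_eq]
    refine ⟨hpS, fun h' => h.2 (convexHull_mono ?_ h')⟩
    rw [Finset.coe_erase]
    exact Set.sdiff_subset_sdiff_left (subset_convexHull ℝ _)
  have hcl := closure_convexHull_extremePoints
    (S.finite_toSet.isCompact_convexHull ℝ) (convex_convexHull ℝ (S : Set Pt))
  rw [← hcl]
  exact ((hullVerts S).finite_toSet.isClosed_convexHull ℝ).closure_subset_iff.2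
    (convexHull_mono hext)

theorem collinear_of_det_eq_zero {p q r : Pt} (hpq : p ≠ q) (h : det p q r = 0) :
    Collinear ℝ ({p, q, r} : Set Pt) := by
  have hr : ∃ t : ℝ, r = t • (q - p) + p := by
    unfold det at h
    by_cases h1 : q.1 - p.1 = 0
    · have h2 : q.2 - p.2 ≠ 0 := fun h2 => hpq (by ext <;> linarith)
      have h3 : r.1 - p.1 = 0 := by
        rw [h1] at h
        simpa [h2] using h
      refine ⟨(r.2 - p.2) / (q.2 - p.2), ?_⟩
      ext
      · simp [h1]; linarith
      · simp; field_simp; ring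
    · refine ⟨(r.1 - p.1) / (q.1 - p.1), ?_⟩
      ext
      · simp; field_simp; ring
      · simp; field_simp; linarith
  obtain ⟨t, ht⟩ := hr
  refine (collinear_iff_of_mem (p₀ := p) (by simp)).2 ⟨q - p, ?_⟩
  rintro s (rfl | rfl | rfl)
  exacts [⟨0, by simp⟩, ⟨1, by simp⟩, ⟨t, by simpa using ht⟩]

theorem GenPos.ccw_or_ccw {S : Finset Pt} (hS : GenPos S) {p q r : Pt} (hp : p ∈ S) (hq : q ∈ S)
    (hr : r ∈ S) (hpq : p ≠ q) (hpr : p ≠ r) (hqr : q ≠ r) : Ccw p q r ∨ Ccw p r q := by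
  rcases lt_trichotomy (det p q r) 0 with h | h | h
  · right
    rw [Ccw, det_swap]
    linarith
  · exact absurd (collinear_of_det_eq_zero hpq h) (hS p hp q hq r hr hpq hpr hqr)
  · exact .inl h

theorem Beyond.of_hullVerts {Q I O : Finset Pt} {R : Set Pt} {x a e : Pt} (hI : hullVerts I = I)
    (hO : hullVerts Q = O) (hIQ : I ⊆ Q) (ha : a ∈ I) (he : e ∈ O) (hR : (I : Set Pt) \ {a} = R)
    (hae : e ∈ IRegion a R) : Beyond (insert x Q) I O x a e where
  corner := by
    rw [← hI] at ha
    simpa using (Finset.mem_filter.1 ha).2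
  beyond := hR ▸ hae
  hull := by
    rw [← hO, convexHull_hullVerts]
    exact subset_convexHull ℝ _ (hIQ ha)
  extreme := by
    rw [← hO] at he
    refine fun h => (Finset.mem_filter.1 he).2 (convexHull_mono ?_ h)
    rintro p ⟨hp, hpe⟩
    simp only [Finset.coe_insert, Set.mem_insert_iff, Set.mem_singleton_iff, not_or] at hp hpe
    simpa [hpe.1] using hp.resolve_left hpe.2

/-- Configuration 8 is saturated: adding any 9th point creates an empty convex pentagon. -/
theorem stmt12 (A B C D E F G H : Pt) (hcfg : Config8 A B C D E F G H) :
    ∀ x, x ∉ ({A, B, C, D, E, F, G, H} : Finset Pt) →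
      GenPos (insert x ({A, B, C, D, E, F, G, H} : Finset Pt)) →
      ∃ S, EmptyConvexPentagon (insert x ({A, B, C, D, E, F, G, H} : Finset Pt)) S := by
  intro x hx hgen
  obtain ⟨hcard, -, hO, hI, iA, iB, iC, iD⟩ := hcfg
  have nd : [A, B, C, D, E, F, G, H].Nodup := by
    rw [← Multiset.coe_nodup, ← Multiset.toFinset_card_eq_card_iff_nodup]
    simpa using hcard
  have N : Nine (insert x {A, B, C, D, E, F, G, H}) x A B C D E F G H :=
    { mem := by simp
      nodup := List.nodup_cons.2 ⟨by simpa using hx, nd⟩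
      gen := fun p hp q hq r hr => hgen.ccw_or_ccw hp hq hr }
  simp only [List.nodup_cons, List.mem_cons, List.not_mem_nil, or_false, not_or] at nd
  have hin : ({A, B, C, D, E, F, G, H} : Finset Pt) \ {E, F, G, H} = {A, B, C, D} := by
    ext p
    simp only [Finset.mem_sdiff, Finset.mem_insert, Finset.mem_singleton, not_or]
    grind
  rw [hin] at hI
  have hIQ := hin ▸ Finset.sdiff_subset
  refine exists_pentagon_of_beyond N.perm (I := ({A, B, C, D} : Finset Pt))
    (O := ({E, F, G, H} : Finset Pt)) (by simp) (by simp)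
    (.of_hullVerts hI hO hIQ (by simp) (by simp) ?_ iA)
    (.of_hullVerts hI hO hIQ (by simp) (by simp) ?_ iB)
    (.of_hullVerts hI hO hIQ (by simp) (by simp) ?_ iC)
    (.of_hullVerts hI hO hIQ (by simp) (by simp) ?_ iD)
  all_goals
    ext p
    simp only [Finset.coe_insert, Finset.coe_singleton, Set.mem_sdiff, Set.mem_insert_iff,
      Set.mem_singleton_iff]
    grind
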